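/- arXiv:1402.0753 — 6 statements merged into one kernel-verified Lean document; each statement's English description precedes it below -/
import Mathlib

section
/- Let N be a positive integer and let A₀, B₀ be N×N complex matrices. Let σ_k ∈ ℂ be a simple generalized eigenvalue of the pencil (A₀, B₀) with normalized eigenvector/adjoint-eigenvector pair (φ_k, ψ_k). Let a, b ∈ ℂᴺ be vectors with bᵀ·adj(σ_k B₀ − A₀)·a ≠ 0, and define f_p(σ) = −det(σB₀ − A₀) / (bᵀ·adj(σB₀ − A₀)·a) on the neighborhood of σ_k where the denominator is nonzero. Then f_p is complex-differentiable at σ_k with f_p′(σ_k) ≠ 0, and (ψ̄_kᵀa)·(bᵀφ_k) = −1 / f_p′(σ_k). -/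
open Matrix

/-- If `M` has a nonzero adjugate entry `(i, j)`, a kernel vector of `M` whose `i`-th coordinate
vanishes is zero. -/
lemma eq_zero_of_mulVec_eq_zero_of_adjugate_ne_zero {n K : Type*} [Fintype n] [DecidableEq n]
    [Field K] {M : Matrix n n K} {i j : n} (hij : M.adjugate i j ≠ 0) {v : n → K}
    (hv : M *ᵥ v = 0) (hvi : v i = 0) : v = 0 := by
  rw [adjugate_apply] at hij
  refine eq_zero_of_mulVec_eq_zero hij ?_
  ext k
  by_cases hk : k = j
  · subst hk
    simp [mulVec, hvi]
  · simpa [mulVec, updateRow_ne hk] using congrFun hv k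

/-- The kernel of a matrix with nonzero adjugate is spanned by any of its nonzero vectors. -/
lemma exists_eq_smul_of_adjugate_ne_zero {n K : Type*} [Fintype n] [DecidableEq n]
    [Field K] {M : Matrix n n K} (hM : M.adjugate ≠ 0) {u v : n → K}
    (hu : M *ᵥ u = 0) (hv : M *ᵥ v = 0) (hv0 : v ≠ 0) : ∃ c : K, u = c • v := by
  obtain ⟨i, j, hij⟩ : ∃ i j, M.adjugate i j ≠ 0 := by
    by_contra! h
    exact hM (Matrix.ext h)
  have hvi : v i ≠ 0 := fun h =>
    hv0 (eq_zero_of_mulVec_eq_zero_of_adjugate_ne_zero hij hv h)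
  refine ⟨u i / v i, sub_eq_zero.mp ?_⟩
  apply eq_zero_of_mulVec_eq_zero_of_adjugate_ne_zero hij
  · simp [mulVec_sub, mulVec_smul, hu, hv]
  · simp [hvi]

/-- The determinant of a matrix with differentiable entries is differentiable. -/
lemma differentiable_matrix_det {n 𝕜 : Type*} [Fintype n] [DecidableEq n]
    [NontriviallyNormedField 𝕜] {M : 𝕜 → Matrix n n 𝕜}
    (hM : ∀ i j, Differentiable 𝕜 fun x => M x i j) :
    Differentiable 𝕜 fun x => (M x).det := by
  simp only [det_apply']
  fun_prop

/-- The adjugate of a matrix with differentiable entries has differentiable entries. -/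
lemma differentiable_matrix_adjugate_apply {n 𝕜 : Type*} [Fintype n] [DecidableEq n]
    [NontriviallyNormedField 𝕜] {M : 𝕜 → Matrix n n 𝕜}
    (hM : ∀ i j, Differentiable 𝕜 fun x => M x i j) (i j : n) :
    Differentiable 𝕜 fun x => (M x).adjugate i j := by
  simp only [adjugate_apply]
  refine differentiable_matrix_det fun k l => ?_
  by_cases hk : k = j
  · subst hk
    simp
  · simpa [updateRow_ne hk] using hM k l

/-- At a simple generalized eigenvalue `σ_k` with normalized pair `(φ_k, ψ_k)`,
the function `f_p(σ) = −det(σB₀ − A₀)/(bᵀ·adj(σB₀ − A₀)·a)` is differentiable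
at `σ_k` with nonzero derivative, and `(ψ̄_kᵀa)·(bᵀφ_k) = −1/f_p′(σ_k)`. -/
theorem stmt_4 (N : ℕ) (hN : 0 < N) (A₀ B₀ : Matrix (Fin N) (Fin N) ℂ)
    (σk : ℂ)
    (h0 : (σk • B₀ - A₀).det = 0)
    (hs : deriv (fun σ : ℂ => (σ • B₀ - A₀).det) σk ≠ 0)
    (φ ψ : Fin N → ℂ)
    (hφ : A₀ *ᵥ φ = σk • (B₀ *ᵥ φ))
    (hψ : star ψ ᵥ* (σk • B₀ - A₀) = 0)
    (hnorm : star ψ ⬝ᵥ (B₀ *ᵥ φ) = 1)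
    (a b : Fin N → ℂ)
    (hab : b ⬝ᵥ ((σk • B₀ - A₀).adjugate *ᵥ a) ≠ 0) :
    ∃ d : ℂ,
      HasDerivAt
        (fun σ : ℂ =>
          -(σ • B₀ - A₀).det / (b ⬝ᵥ ((σ • B₀ - A₀).adjugate *ᵥ a))) d σk ∧
      d ≠ 0 ∧ (star ψ ⬝ᵥ a) * (b ⬝ᵥ φ) = -1 / d := by
  have hM : ∀ i j, Differentiable ℂ fun σ : ℂ => (σ • B₀ - A₀) i j := fun i j => by
    simp only [Matrix.sub_apply, Matrix.smul_apply, smul_eq_mul]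
    fun_prop
  have hadj := differentiable_matrix_adjugate_apply hM
  have hdet : HasDerivAt (fun σ : ℂ => (σ • B₀ - A₀).det) _ σk :=
    (differentiable_matrix_det hM σk).hasDerivAt
  have hdot : ∀ c : Fin N → ℂ,
      Differentiable ℂ fun σ : ℂ => c ⬝ᵥ ((σ • B₀ - A₀).adjugate *ᵥ a) := fun c => by
    simp only [dotProduct, mulVec]
    fun_prop
  set h' := deriv (fun σ : ℂ => (σ • B₀ - A₀).det) σk
  have hφ0 : φ ≠ 0 := by
    rintro rfl
    simp at hnorm
  have hadj0 : (σk • B₀ - A₀).adjugate ≠ 0 := fun h => hab (by simp [h])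
  obtain ⟨c, hc⟩ := exists_eq_smul_of_adjugate_ne_zero hadj0
    (u := (σk • B₀ - A₀).adjugate *ᵥ a) (v := φ)
    (by rw [mulVec_mulVec, mul_adjugate, h0, zero_smul, zero_mulVec])
    (by rw [sub_mulVec, smul_mulVec, hφ, sub_self]) hφ0
  have key : ∀ σ : ℂ, (σ - σk) * ((star ψ ᵥ* B₀) ⬝ᵥ ((σ • B₀ - A₀).adjugate *ᵥ a))
      = (σ • B₀ - A₀).det * (star ψ ⬝ᵥ a) := fun σ => by
    have h1 : star ψ ᵥ* (σ • B₀ - A₀) = (σ - σk) • (star ψ ᵥ* B₀) := by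
      have : σ • B₀ - A₀ = (σ - σk) • B₀ + (σk • B₀ - A₀) := by
        rw [sub_smul]; abel
      rw [this, vecMul_add, hψ, add_zero, vecMul_smul]
    rw [← smul_eq_mul, ← smul_dotProduct, ← h1, ← dotProduct_mulVec, mulVec_mulVec,
      mul_adjugate, smul_mulVec, one_mulVec, dotProduct_smul, smul_eq_mul]
  have hca : c = h' * (star ψ ⬝ᵥ a) := by
    have e1 := ((hasDerivAt_id σk).sub_const σk).mul (hdot (star ψ ᵥ* B₀) σk).hasDerivAt
    have e2 := (hdet.mul_const (star ψ ⬝ᵥ a)).congr_of_eventuallyEq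
      (Filter.Eventually.of_forall key)
    have e := e1.unique e2
    simpa [hc, ← dotProduct_mulVec, hnorm] using e
  have hbc : b ⬝ᵥ ((σk • B₀ - A₀).adjugate *ᵥ a) = h' * ((star ψ ⬝ᵥ a) * (b ⬝ᵥ φ)) := by
    rw [hc, dotProduct_smul, smul_eq_mul, hca, mul_assoc]
  refine ⟨-h' / (b ⬝ᵥ ((σk • B₀ - A₀).adjugate *ᵥ a)), ?_, div_ne_zero (neg_ne_zero.mpr hs) hab,
    ?_⟩
  · refine (hdet.fun_neg.fun_div (hdot b σk).hasDerivAt hab).congr_deriv ?_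
    rw [h0, neg_zero, zero_mul, sub_zero, sq, mul_div_mul_right _ _ hab]
  · rw [neg_div _ h', neg_div_neg_eq, one_div_div, hbc, mul_div_cancel_left₀ _ hs]
end

section
/- Let p and q be polynomials with complex coefficients such that p is nonzero, deg q < deg p, and every root of p is simple (i.e. p′(σ) ≠ 0 for every root σ of p). Let σ₁, …, σ_N be the distinct roots of p (where N = deg p, since p splits over ℂ). Then for every w ∈ ℂ with p(w) ≠ 0, the partial fraction expansion q(w)/p(w) = Σ_{k=1}^{N} q(σ_k) / (p′(σ_k)·(w − σ_k)) holds. -/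
open Polynomial

theorem Polynomial.nodup_roots_of_derivative_eval_ne_zero {R : Type*} [CommRing R] [IsDomain R]
    {p : R[X]} (hp : p ≠ 0) (hsimple : ∀ σ : R, p.IsRoot σ → p.derivative.eval σ ≠ 0) :
    p.roots.Nodup := by
  classical
  rw [Multiset.nodup_iff_count_le_one]
  intro σ
  rw [count_roots]
  by_contra! h
  obtain ⟨h₁, h₂⟩ := (one_lt_rootMultiplicity_iff_isRoot hp).1 h
  exact hsimple σ h₁ h₂

theorem Polynomial.Splits.eq_C_leadingCoeff_mul_nodal {F : Type*} [Field F] [DecidableEq F]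
    {p : F[X]} (hs : p.Splits) (hn : p.roots.Nodup) :
    p = C p.leadingCoeff * Lagrange.nodal p.roots.toFinset id := by
  conv_lhs => rw [hs.eq_prod_roots]
  rw [Lagrange.nodal, Finset.prod, Multiset.toFinset_val, hn.dedup]
  rfl

/-- Partial fraction expansion: if `p ≠ 0`, `deg q < deg p` and all roots of `p`
are simple, then for `w` with `p(w) ≠ 0`,
`q(w)/p(w) = Σ_{σ root of p} q(σ)/(p′(σ)·(w − σ))`. -/
theorem stmt_7 (p q : Polynomial ℂ) (hp : p ≠ 0) (hdeg : q.degree < p.degree)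
    (hsimple : ∀ σ : ℂ, p.IsRoot σ → p.derivative.eval σ ≠ 0)
    (w : ℂ) (hw : p.eval w ≠ 0) :
    q.eval w / p.eval w =
      ∑ σ ∈ p.roots.toFinset, q.eval σ / (p.derivative.eval σ * (w - σ)) := by
  have hn := nodup_roots_of_derivative_eval_ne_zero hp hsimple
  have hs : p.Splits := IsAlgClosed.splits p
  have hfac := hs.eq_C_leadingCoeff_mul_nodal hn
  have hc : p.leadingCoeff ≠ 0 := leadingCoeff_ne_zero.2 hp
  have hcard : q.degree < p.roots.toFinset.card := by
    rwa [Multiset.toFinset_card_of_nodup hn, ← hs.natDegree_eq_card_roots,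
      ← degree_eq_natDegree hp]
  have hnode : ∀ σ ∈ p.roots.toFinset, w ≠ id σ := by
    rintro σ hσ rfl
    exact hw (isRoot_of_mem_roots (Multiset.mem_toFinset.1 hσ))
  have hq := congrArg (eval w) (Lagrange.eq_interpolate (Set.injOn_id _) hcard)
  rw [Lagrange.eval_interpolate_not_at_node _ hnode] at hq
  have hpw : p.eval w = p.leadingCoeff * (Lagrange.nodal p.roots.toFinset id).eval w := by
    conv_lhs => rw [hfac, eval_mul, eval_C]
  have hw' : (Lagrange.nodal p.roots.toFinset id).eval w ≠ 0 := right_ne_zero_of_mul (hpw ▸ hw)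
  rw [hq, hpw, mul_comm p.leadingCoeff, mul_div_mul_left _ _ hw', Finset.sum_div]
  refine Finset.sum_congr rfl fun σ hσ => ?_
  have hd : p.derivative.eval σ =
      p.leadingCoeff * (derivative (Lagrange.nodal p.roots.toFinset id)).eval σ := by
    conv_lhs => rw [hfac, derivative_C_mul, eval_mul, eval_C]
  rw [Lagrange.nodalWeight_eq_eval_derivative_nodal hσ, hd]
  simp only [id, div_eq_mul_inv, mul_inv]
  ring
end

section
/- Let p and q be polynomials with complex coefficients such that p is nonzero, deg q < deg p, and every root of p is simple; let σ₁, …, σ_N be the distinct roots of p (N = deg p). Let M be a positive integer, let μ₁, …, μ_M ∈ ℂ be distinct, let r₁, …, r_M ∈ ℂ, and define G(z) = Σ_{m=1}^{M} r_m/(z − μ_m). Fix ζ ∈ ℂ such that p(ζ − μ_m) ≠ 0 for every m (equivalently, ζ − σ_k ≠ μ_m for all k, m). Then the sum over the eigenvalues converts to a sum over the poles of G: Σ_{k=1}^{N} (q(σ_k)/p′(σ_k))·G(ζ − σ_k) = Σ_{m=1}^{M} r_m·q(ζ − μ_m)/p(ζ − μ_m). (Interpreting f = p/q, the left side is Σ_k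 G(ζ − σ_k)/f′(σ_k) and the right side is Σ_m r_m/f(ζ − μ_m), which is the identity I_p = −Σ_m r_m/f_p(σ_p − μ_m) of Theorem 3.1 for a meromorphic extended power spectral density G with simple poles μ_m and residues r_m.) -/
open Polynomial

/-- A split polynomial with simple roots is its leading coefficient times the nodal polynomial of
its set of roots. -/
theorem Polynomial.Splits.eq_C_mul_nodal_roots {F : Type*} [Field F] [DecidableEq F] {p : F[X]}
    (hs : p.Splits) (hnodup : p.roots.Nodup) :
    p = C p.leadingCoeff * Lagrange.nodal p.roots.toFinset id := by
  have h : Lagrange.nodal p.roots.toFinset id = (p.roots.map fun a => X - C a).prod := by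
    rw [Lagrange.nodal_eq, Finset.prod_eq_multiset_prod, Multiset.toFinset_val,
      hnodup.dedup]
    rfl
  rw [h]
  exact hs.eq_prod_roots

/-- A polynomial none of whose roots is a root of its derivative has no repeated roots. -/
theorem Polynomial.nodup_roots_of_eval_derivative_ne_zero {F : Type*} [Field F] {p : F[X]}
    (hp : p ≠ 0) (hsimple : ∀ σ, p.IsRoot σ → p.derivative.eval σ ≠ 0) : p.roots.Nodup := by
  classical
  rw [Multiset.nodup_iff_count_le_one]
  intro a
  rw [count_roots]
  by_contra! h
  obtain ⟨h₁, h₂⟩ := (one_lt_rootMultiplicity_iff_isRoot hp).1 h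
  exact hsimple a h₁ h₂

/-- Partial fraction decomposition of `q / p` for a split polynomial `p` with simple roots. -/
theorem Polynomial.Splits.sum_eval_div_derivative_mul_inv_sub {F : Type*} [Field F]
    [DecidableEq F] {p q : F[X]} (hs : p.Splits) (hp : p ≠ 0) (hnodup : p.roots.Nodup)
    (hdeg : q.degree < p.degree) {w : F} (hw : p.eval w ≠ 0) :
    ∑ σ ∈ p.roots.toFinset, q.eval σ / p.derivative.eval σ * (w - σ)⁻¹
      = q.eval w / p.eval w := by
  have hnodal := hs.eq_C_mul_nodal_roots hnodup
  set s := p.roots.toFinset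
  set a := p.leadingCoeff
  have ha : a ≠ 0 := leadingCoeff_ne_zero.2 hp
  have hcard : p.degree = s.card := by
    rw [hnodal, degree_C_mul ha, Lagrange.degree_nodal]
  have hq : q = Lagrange.interpolate s id fun σ => q.eval σ :=
    Lagrange.eq_interpolate Function.injective_id.injOn (hcard ▸ hdeg)
  have hws : ∀ σ ∈ s, w ≠ id σ := by
    rintro σ hσ rfl
    exact hw (isRoot_of_mem_roots (Multiset.mem_toFinset.1 hσ))
  have hqw : q.eval w = (Lagrange.nodal s id).eval w *
      ∑ σ ∈ s, Lagrange.nodalWeight s id σ * (w - σ)⁻¹ * q.eval σ := by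
    conv_lhs => rw [hq]
    exact Lagrange.eval_interpolate_not_at_node _ hws
  have hpw : p.eval w = a * (Lagrange.nodal s id).eval w := by
    conv_lhs => rw [hnodal]
    simp
  rw [eq_div_iff hw, hqw, hpw, Finset.sum_mul, Finset.mul_sum]
  refine Finset.sum_congr rfl fun σ hσ => ?_
  have hd : p.derivative.eval σ = a * (Lagrange.nodal s id).derivative.eval σ := by
    conv_lhs => rw [hnodal]
    simp
  rw [hd, Lagrange.nodalWeight_eq_eval_derivative_nodal hσ, id_eq, div_eq_mul_inv, mul_inv]
  linear_combination (q.eval σ * ((Lagrange.nodal s id).derivative.eval σ)⁻¹ * (w - σ)⁻¹ *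
    (Lagrange.nodal s id).eval w) * mul_inv_cancel₀ ha

/-- Converting a sum over the (simple) roots `σ_k` of `p` into a sum over the
poles `μ_m` of `G(z) = Σ_m r_m/(z − μ_m)`:
`Σ_k (q(σ_k)/p′(σ_k))·G(ζ − σ_k) = Σ_m r_m·q(ζ − μ_m)/p(ζ − μ_m)`. -/
theorem stmt_8 (p q : Polynomial ℂ) (hp : p ≠ 0) (hdeg : q.degree < p.degree)
    (hsimple : ∀ σ : ℂ, p.IsRoot σ → p.derivative.eval σ ≠ 0)
    (M : ℕ) (hM : 0 < M) (μ : Fin M → ℂ) (hμ : Function.Injective μ)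
    (r : Fin M → ℂ) (ζ : ℂ) (hζ : ∀ m : Fin M, p.eval (ζ - μ m) ≠ 0) :
    ∑ σ ∈ p.roots.toFinset,
        (q.eval σ / p.derivative.eval σ) * (∑ m : Fin M, r m / ((ζ - σ) - μ m))
      = ∑ m : Fin M, r m * q.eval (ζ - μ m) / p.eval (ζ - μ m) := by
  have hnodup := nodup_roots_of_eval_derivative_ne_zero hp hsimple
  simp_rw [Finset.mul_sum]
  rw [Finset.sum_comm]
  refine Finset.sum_congr rfl fun m _ => ?_
  rw [mul_div_assoc, ← (IsAlgClosed.splits p).sum_eval_div_derivative_mul_inv_sub hp hnodup hdeg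
    (hζ m), Finset.mul_sum]
  refine Finset.sum_congr rfl fun σ _ => ?_
  rw [sub_right_comm ζ σ (μ m)]
  ring
end

section
/- Let N be a positive integer, let A₀ and B₀ be N×N complex matrices, and let u, v ∈ ℂᴺ. Let σ_p ∈ ℂ be a simple generalized eigenvalue of the pencil (A₀, B₀) with normalized eigenvector/adjoint-eigenvector pair (φ_p, ψ_p), and suppose vᵀ·adj(σ_p B₀ − A₀)·u ≠ 0. Define f_A(σ) = −det(σB₀ − A₀)/(vᵀ·adj(σB₀ − A₀)·u) near σ_p, and set a_p = (vᵀφ_p)·u and b_p = (ψ̄_pᵀu)·v (so that a_p·b_pᵀ = (u·vᵀ)φ_pψ̄_pᵀ(u·vᵀ)). Then for every σ ∈ ℂ with vᵀ·adj(σB₀ − A₀)·u ≠ 0, the function f_p(σ) = −det(σB₀ − A₀)/(b_pᵀ·adj(σB₀ − A₀)·a_p) satisfies f_p(σ) = −f_A(σ)·f_A′(σ_p), where f_A′(σ_p) is the complex derivative of f_A at σ_p. -/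
open Matrix

open Filter Topology

/-- The **matrix determinant lemma** for an invertible matrix, in adjugate form. -/
theorem det_add_vecMulVec_of_det_ne_zero {n : Type*} [Fintype n] [DecidableEq n] {K : Type*}
    [Field K] {M : Matrix n n K} (hM : M.det ≠ 0) (x y : n → K) :
    (M + vecMulVec x y).det = M.det + y ⬝ᵥ (M.adjugate *ᵥ x) := by
  have hu : IsUnit M.det := isUnit_iff_ne_zero.mpr hM
  have hfac : M + vecMulVec x y = M * (1 + vecMulVec (M⁻¹ *ᵥ x) y) := by
    rw [mul_add, mul_one, mul_vecMulVec, mulVec_mulVec, mul_nonsing_inv _ hu, one_mulVec]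
  rw [hfac, det_mul, vecMulVec_eq Unit, det_one_add_replicateCol_mul_replicateRow, inv_def,
    smul_mulVec, dotProduct_smul, smul_eq_mul, mul_add, mul_one, ← mul_assoc,
    Ring.mul_inverse_cancel _ hu, one_mul]

theorem continuous_pencil {n : Type*} (A B : Matrix n n ℂ) : Continuous fun σ : ℂ => σ • B - A := by
  fun_prop

section Pencil

variable {n : Type*} [Fintype n] [DecidableEq n] {A B : Matrix n n ℂ} {σ₀ d : ℂ}

theorem tendsto_adjugate_pencil_mulVec (A B : Matrix n n ℂ) (σ₀ : ℂ) (x : n → ℂ) :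
    Tendsto (fun σ : ℂ => (σ • B - A).adjugate *ᵥ x) (𝓝[≠] σ₀)
      (𝓝 ((σ₀ • B - A).adjugate *ᵥ x)) :=
  (((continuous_pencil A B).matrix_adjugate.matrix_mulVec
    continuous_const).tendsto σ₀).mono_left nhdsWithin_le_nhds

/-- The adjugate of the pencil at a root of the determinant, applied to `B φ`. -/
theorem adjugate_pencil_mulVec (h0 : (σ₀ • B - A).det = 0)
    (hd : HasDerivAt (fun σ : ℂ => (σ • B - A).det) d σ₀) {φ : n → ℂ}
    (hφ : A *ᵥ φ = σ₀ • (B *ᵥ φ)) :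
    (σ₀ • B - A).adjugate *ᵥ (B *ᵥ φ) = d • φ := by
  have hslope := hd.tendsto_slope.smul_const φ
  refine tendsto_nhds_unique (tendsto_adjugate_pencil_mulVec A B σ₀ (B *ᵥ φ))
    (hslope.congr' ?_)
  filter_upwards [self_mem_nhdsWithin] with σ hσ
  have hne : σ - σ₀ ≠ 0 := sub_ne_zero.mpr hσ
  have hM : (σ • B - A) *ᵥ φ = (σ - σ₀) • (B *ᵥ φ) := by
    rw [sub_mulVec, smul_mulVec, hφ, sub_smul]
  have key : (σ • B - A).det • φ = (σ - σ₀) • ((σ • B - A).adjugate *ᵥ (B *ᵥ φ)) := by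
    rw [← mulVec_smul, ← hM, mulVec_mulVec, adjugate_mul, smul_mulVec, one_mulVec]
  rw [slope_def_field, h0, sub_zero, div_eq_inv_mul, mul_smul, key, inv_smul_smul₀ hne]

/-- The matrix determinant lemma at a simple root of the determinant of a pencil. -/
theorem det_pencil_add_vecMulVec (hd : HasDerivAt (fun σ : ℂ => (σ • B - A).det) d σ₀)
    (hd0 : d ≠ 0) (x y : n → ℂ) :
    (σ₀ • B - A + vecMulVec x y).det =
      (σ₀ • B - A).det + y ⬝ᵥ ((σ₀ • B - A).adjugate *ᵥ x) := by
  have hl : Tendsto (fun σ : ℂ => (σ • B - A + vecMulVec x y).det) (𝓝[≠] σ₀)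
      (𝓝 (σ₀ • B - A + vecMulVec x y).det) :=
    (((continuous_pencil A B).add continuous_const).matrix_det.tendsto σ₀).mono_left
      nhdsWithin_le_nhds
  have hr : Tendsto (fun σ : ℂ => (σ • B - A).det + y ⬝ᵥ ((σ • B - A).adjugate *ᵥ x))
      (𝓝[≠] σ₀) (𝓝 ((σ₀ • B - A).det + y ⬝ᵥ ((σ₀ • B - A).adjugate *ᵥ x))) :=
    (((continuous_pencil A B).matrix_det.add (continuous_const.dotProduct
      ((continuous_pencil A B).matrix_adjugate.matrix_mulVec
        continuous_const))).tendsto σ₀).mono_left nhdsWithin_le_nhds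
  refine tendsto_nhds_unique hl (hr.congr' ?_)
  filter_upwards [hd.eventually_ne hd0] with σ hσ
  exact (det_add_vecMulVec_of_det_ne_zero hσ x y).symm

/-- At a simple generalized eigenvalue the adjugate of the pencil is the multiple
`d • φ χᵀ` of the normalized spectral projector, `d` being the derivative of the determinant. -/
theorem adjugate_pencil_eq_smul_vecMulVec (h0 : (σ₀ • B - A).det = 0)
    (hd : HasDerivAt (fun σ : ℂ => (σ • B - A).det) d σ₀) (hd0 : d ≠ 0) {φ χ : n → ℂ}
    (hφ : A *ᵥ φ = σ₀ • (B *ᵥ φ)) (hχ : χ ᵥ* (σ₀ • B - A) = 0)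
    (hnorm : χ ⬝ᵥ (B *ᵥ φ) = 1) :
    (σ₀ • B - A).adjugate = d • vecMulVec φ χ := by
  set K := σ₀ • B - A + vecMulVec (B *ᵥ φ) (χ ᵥ* B) with hK
  have hKdet : K.det = d := by
    rw [hK, det_pencil_add_vecMulVec hd hd0, h0, zero_add, adjugate_pencil_mulVec h0 hd hφ,
      dotProduct_smul, ← dotProduct_mulVec, hnorm, smul_eq_mul, mul_one]
  have hKunit : IsUnit K := by
    rw [isUnit_iff_isUnit_det, hKdet]
    exact isUnit_iff_ne_zero.mpr hd0
  refine hKunit.mul_right_cancel ?_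
  rw [hK, mul_add, mul_add, adjugate_mul, h0, zero_smul, zero_add, mul_vecMulVec,
    adjugate_pencil_mulVec h0 hd hφ, smul_mul_assoc, smul_mul_assoc, vecMulVec_mul,
    vecMulVec_mul_vecMulVec, hχ, hnorm]
  simp

end Pencil

/-- The derivative of a quotient at a zero of its numerator. -/
theorem HasDerivAt.div_of_eq_zero {𝕜 : Type*} [NontriviallyNormedField 𝕜] {f g : 𝕜 → 𝕜}
    {x f' : 𝕜} (hf : HasDerivAt f f' x) (hfx : f x = 0) (hg : ContinuousAt g x)
    (hgx : g x ≠ 0) : HasDerivAt (fun y => f y / g y) (f' / g x) x := by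
  rw [hasDerivAt_iff_tendsto_slope]
  refine (hf.tendsto_slope.div (hg.tendsto.mono_left nhdsWithin_le_nhds) hgx).congr fun y => ?_
  simp only [Pi.div_apply, slope_def_field, hfx, zero_div, sub_zero]
  exact div_right_comm _ _ _

/-- With `A₁ = u·vᵀ` rank one, `a_p = (vᵀφ_p)·u`, `b_p = (ψ̄_pᵀu)·v`, the
function `f_p(σ) = −det(σB₀ − A₀)/(b_pᵀ·adj(σB₀ − A₀)·a_p)` satisfies
`f_p(σ) = −f_A(σ)·f_A′(σ_p)` wherever `vᵀ·adj(σB₀ − A₀)·u ≠ 0`, where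
`f_A(σ) = −det(σB₀ − A₀)/(vᵀ·adj(σB₀ − A₀)·u)`. -/
theorem stmt_10 (N : ℕ) (hN : 0 < N) (A₀ B₀ : Matrix (Fin N) (Fin N) ℂ)
    (u v : Fin N → ℂ) (σp : ℂ)
    (h0 : (σp • B₀ - A₀).det = 0)
    (hs : deriv (fun σ : ℂ => (σ • B₀ - A₀).det) σp ≠ 0)
    (φ ψ : Fin N → ℂ)
    (hφ : A₀ *ᵥ φ = σp • (B₀ *ᵥ φ))
    (hψ : star ψ ᵥ* (σp • B₀ - A₀) = 0)
    (hnorm : star ψ ⬝ᵥ (B₀ *ᵥ φ) = 1)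
    (hadjp : v ⬝ᵥ ((σp • B₀ - A₀).adjugate *ᵥ u) ≠ 0) :
    ∀ σ : ℂ, v ⬝ᵥ ((σ • B₀ - A₀).adjugate *ᵥ u) ≠ 0 →
      -(σ • B₀ - A₀).det /
          (((star ψ ⬝ᵥ u) • v) ⬝ᵥ ((σ • B₀ - A₀).adjugate *ᵥ ((v ⬝ᵥ φ) • u)))
        = -(-(σ • B₀ - A₀).det / (v ⬝ᵥ ((σ • B₀ - A₀).adjugate *ᵥ u)))
            * deriv (fun σ' : ℂ =>
                -(σ' • B₀ - A₀).det / (v ⬝ᵥ ((σ' • B₀ - A₀).adjugate *ᵥ u))) σp := by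
  intro σ hσ
  have hd := (differentiableAt_of_deriv_ne_zero hs).hasDerivAt
  have hadj := adjugate_pencil_eq_smul_vecMulVec h0 hd hs hφ hψ hnorm
  set d := deriv (fun σ : ℂ => (σ • B₀ - A₀).det) σp
  have hg : Continuous fun σ : ℂ => v ⬝ᵥ ((σ • B₀ - A₀).adjugate *ᵥ u) :=
    continuous_const.dotProduct
      ((continuous_pencil A₀ B₀).matrix_adjugate.matrix_mulVec continuous_const)
  have hgp : v ⬝ᵥ ((σp • B₀ - A₀).adjugate *ᵥ u) = d * ((star ψ ⬝ᵥ u) * (v ⬝ᵥ φ)) := by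
    rw [hadj, smul_mulVec, vecMulVec_mulVec, dotProduct_smul, op_smul_eq_smul,
      dotProduct_smul, smul_eq_mul, smul_eq_mul]
  have hderiv : HasDerivAt (fun σ' : ℂ =>
      -(σ' • B₀ - A₀).det / (v ⬝ᵥ ((σ' • B₀ - A₀).adjugate *ᵥ u)))
      (-d / (v ⬝ᵥ ((σp • B₀ - A₀).adjugate *ᵥ u))) σp :=
    hd.fun_neg.div_of_eq_zero (by rw [h0, neg_zero]) hg.continuousAt hadjp
  rw [hderiv.deriv, hgp, smul_dotProduct, mulVec_smul, dotProduct_smul, smul_eq_mul, smul_eq_mul]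
  rw [hgp] at hadjp
  have hc := right_ne_zero_of_mul hadjp
  have h1 := left_ne_zero_of_mul hc
  have h2 := right_ne_zero_of_mul hc
  field_simp
end

section
/- Let a > 0 and ω₀ ∈ ℝ, and define the power spectral density S(ω) = (ω⁴·a³/(π·A_nor))·(1/(a⁸ + (ω − ω₀)⁸) + 1/(a⁸ + (ω + ω₀)⁸)) with normalization constant A_nor = ((1 + √2)·ω₀⁴/a⁴ + 6·ω₀²/a² + 1)·√(1 − 1/√2). Then ∫_{−∞}^{∞} S(ω) dω = 1. -/
/-- The normalization constant `A_nor` of the power spectral density. -/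
noncomputable def Anor (a ω₀ : ℝ) : ℝ :=
  ((1 + Real.sqrt 2) * ω₀ ^ 4 / a ^ 4 + 6 * ω₀ ^ 2 / a ^ 2 + 1) *
    Real.sqrt (1 - 1 / Real.sqrt 2)

/-- The power spectral density
`S(ω) = (ω⁴a³/(π·A_nor))·(1/(a⁸ + (ω − ω₀)⁸) + 1/(a⁸ + (ω + ω₀)⁸))`. -/
noncomputable def Spsd (a ω₀ : ℝ) (ω : ℝ) : ℝ :=
  ω ^ 4 * a ^ 3 / (Real.pi * Anor a ω₀) *
    (1 / (a ^ 8 + (ω - ω₀) ^ 8) + 1 / (a ^ 8 + (ω + ω₀) ^ 8))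

open Real MeasureTheory Filter Topology

/-- A palindromic quartic without real roots when `c ^ 2 < 4`. -/
def palQuartic (c x : ℝ) : ℝ := (x ^ 2 - c * x + 1) * (x ^ 2 + c * x + 1)

lemma quadratic_pos {c : ℝ} (hc : c ^ 2 < 4) (x : ℝ) : 0 < x ^ 2 + c * x + 1 := by
  nlinarith [sq_nonneg (2 * x + c)]

lemma quadratic_pos' {c : ℝ} (hc : c ^ 2 < 4) (x : ℝ) : 0 < x ^ 2 - c * x + 1 := by
  nlinarith [sq_nonneg (2 * x - c)]

lemma palQuartic_pos {c : ℝ} (hc : c ^ 2 < 4) (x : ℝ) : 0 < palQuartic c x :=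
  mul_pos (quadratic_pos' hc x) (quadratic_pos hc x)

lemma palQuartic_ge (c x : ℝ) : (1 - c ^ 2 / 4) * (1 + x ^ 2) ^ 2 ≤ palQuartic c x := by
  unfold palQuartic
  nlinarith [mul_nonneg (sq_nonneg c) (sq_nonneg (x ^ 2 - 1))]

lemma integrable_div_palQuartic {c : ℝ} (hc : c ^ 2 < 4) {p : ℝ → ℝ} (hp : Continuous p)
    (hb : ∀ x, |p x| ≤ 1 + x ^ 2) : Integrable fun x => p x / palQuartic c x := by
  refine (integrable_inv_one_add_sq.const_mul (1 - c ^ 2 / 4)⁻¹).mono' ?_ ?_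
  · refine (hp.div ?_ fun x => (palQuartic_pos hc x).ne').aestronglyMeasurable
    unfold palQuartic
    fun_prop
  · refine .of_forall fun x => ?_
    have hk : 0 < 1 - c ^ 2 / 4 := by linarith
    have hx : 0 < 1 + x ^ 2 := by positivity
    rw [norm_div, Real.norm_eq_abs, Real.norm_eq_abs, abs_of_pos (palQuartic_pos hc x)]
    calc |p x| / palQuartic c x ≤ (1 + x ^ 2) / ((1 - c ^ 2 / 4) * (1 + x ^ 2) ^ 2) := by
          gcongr
          · exact hb x
          · exact palQuartic_ge c x
      _ = (1 - c ^ 2 / 4)⁻¹ * (1 + x ^ 2)⁻¹ := by field_simp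

lemma integrable_add_one_div_palQuartic {c : ℝ} (hc : c ^ 2 < 4) :
    Integrable fun x => (x ^ 2 + 1) / palQuartic c x :=
  integrable_div_palQuartic hc (by fun_prop) fun x => by
    rw [abs_of_pos (by positivity), add_comm]

lemma integrable_sub_one_div_palQuartic {c : ℝ} (hc : c ^ 2 < 4) :
    Integrable fun x => (x ^ 2 - 1) / palQuartic c x :=
  integrable_div_palQuartic hc (by fun_prop) fun x => by
    rw [abs_le]
    constructor <;> nlinarith [sq_nonneg x]

lemma integral_add_one_div_palQuartic {c e : ℝ} (he : 0 < e) (hce : c ^ 2 + e ^ 2 = 4) :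
    ∫ x, (x ^ 2 + 1) / palQuartic c x = 2 * π / e := by
  have hc : c ^ 2 < 4 := by nlinarith
  have hderiv (x : ℝ) : HasDerivAt
      (fun x => e⁻¹ * (arctan ((2 * x + c) / e) + arctan ((2 * x - c) / e)))
      ((x ^ 2 + 1) / palQuartic c x) x := by
    have h1 : HasDerivAt (fun x : ℝ => (2 * x + c) / e) (2 / e) x := by
      simpa using (((hasDerivAt_id x).const_mul 2).add_const c).div_const e
    have h2 : HasDerivAt (fun x : ℝ => (2 * x - c) / e) (2 / e) x := by
      simpa using (((hasDerivAt_id x).const_mul 2).sub_const c).div_const e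
    refine ((h1.arctan.add h2.arctan).const_mul e⁻¹).congr_deriv ?_
    have hp := quadratic_pos hc x
    have hm := quadratic_pos' hc x
    have e1 : 1 + ((2 * x + c) / e) ^ 2 = 4 * (x ^ 2 + c * x + 1) / e ^ 2 := by
      field_simp
      linarith
    have e2 : 1 + ((2 * x - c) / e) ^ 2 = 4 * (x ^ 2 - c * x + 1) / e ^ 2 := by
      field_simp
      linarith
    have e3 : x ^ 2 + 1 = ((x ^ 2 + c * x + 1) + (x ^ 2 - c * x + 1)) / 2 := by ring
    rw [e1, e2, palQuartic, e3]
    generalize x ^ 2 + c * x + 1 = p at hp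
    generalize x ^ 2 - c * x + 1 = q at hm
    field_simp
    ring
  have htop (b : ℝ) : Tendsto (fun x => arctan ((2 * x + b) / e)) atTop (𝓝 (π / 2)) :=
    (tendsto_arctan_atTop.mono_right nhdsWithin_le_nhds).comp
      ((tendsto_atTop_add_const_right _ b
        (tendsto_id.const_mul_atTop two_pos)).atTop_div_const he)
  have hbot (b : ℝ) : Tendsto (fun x => arctan ((2 * x + b) / e)) atBot (𝓝 (-(π / 2))) :=
    (tendsto_arctan_atBot.mono_right nhdsWithin_le_nhds).comp
      ((tendsto_atBot_add_const_right _ b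
        (tendsto_id.const_mul_atBot two_pos)).atBot_div_const he)
  rw [integral_of_hasDerivAt_of_tendsto hderiv (integrable_add_one_div_palQuartic hc)
    (((hbot c).add (hbot (-c))).const_mul e⁻¹) (((htop c).add (htop (-c))).const_mul e⁻¹)]
  field_simp
  ring

lemma integral_sub_one_div_palQuartic {c : ℝ} (hc0 : c ≠ 0) (hc : c ^ 2 < 4) :
    ∫ x, (x ^ 2 - 1) / palQuartic c x = 0 := by
  have hderiv (x : ℝ) : HasDerivAt
      (fun x => (2 * c)⁻¹ * log ((x ^ 2 - c * x + 1) / (x ^ 2 + c * x + 1)))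
      ((x ^ 2 - 1) / palQuartic c x) x := by
    have hp := quadratic_pos hc x
    have hm := quadratic_pos' hc x
    have h1 : HasDerivAt (fun x : ℝ => x ^ 2 + c * x + 1) (2 * x + c) x := by
      simpa using ((hasDerivAt_pow 2 x).add ((hasDerivAt_id x).const_mul c)).add_const 1
    have h2 : HasDerivAt (fun x : ℝ => x ^ 2 - c * x + 1) (2 * x - c) x := by
      simpa using ((hasDerivAt_pow 2 x).sub ((hasDerivAt_id x).const_mul c)).add_const 1
    refine (((h2.div h1 hp.ne').log (div_pos hm hp).ne').const_mul (2 * c)⁻¹).congr_deriv ?_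
    simp only [Pi.div_apply, palQuartic]
    field_simp
    ring
  have hlim {l : Filter ℝ} (hl : Tendsto (fun x : ℝ => x⁻¹) l (𝓝 0)) (h0 : ∀ᶠ x in l, x ≠ 0) :
      Tendsto (fun x => (2 * c)⁻¹ * log ((x ^ 2 - c * x + 1) / (x ^ 2 + c * x + 1))) l
        (𝓝 0) := by
    have hcont : ContinuousAt
        (fun y : ℝ => (2 * c)⁻¹ * log ((y ^ 2 - c * y + 1) / (y ^ 2 + c * y + 1))) 0 :=
      (hderiv 0).continuousAt
    have := hcont.tendsto.comp hl
    simp only [ne_eq, OfNat.ofNat_ne_zero, not_false_eq_true, zero_pow, mul_zero, sub_zero,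
      zero_add, add_zero, div_one, log_one] at this
    refine this.congr' ?_
    filter_upwards [h0] with x hx
    simp only [Function.comp_apply]
    congr 2
    have hp := (quadratic_pos hc x).ne'
    have hp' := (quadratic_pos hc x⁻¹).ne'
    rw [div_eq_div_iff hp' hp]
    field_simp
    ring
  rw [integral_of_hasDerivAt_of_tendsto hderiv (integrable_sub_one_div_palQuartic hc)
    (hlim tendsto_inv_atBot_zero (eventually_ne_atBot 0))
    (hlim tendsto_inv_atTop_zero (eventually_ne_atTop 0)), sub_zero]

/-- Partial fractions over the factorization of `1 + x ^ 8` into two palindromic quartics. -/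
lemma even_quartic_div_eq {s c d : ℝ} (hs : s ^ 2 = 2) (hc : c ^ 2 = 2 + s) (hd : d ^ 2 = 2 - s)
    (A B C x : ℝ) (hqc : palQuartic c x ≠ 0) (hqd : palQuartic d x ≠ 0) :
    (A * x ^ 4 + B * x ^ 2 + C) / (1 + x ^ 8) =
      ((A - C + B) / (4 * s) + C / 4) * ((x ^ 2 + 1) / palQuartic c x) +
      (C / 4 - (A - C + B) / (4 * s)) * ((x ^ 2 + 1) / palQuartic d x) +
      ((A - C - B) / (4 * s) - C / 4) * ((x ^ 2 - 1) / palQuartic c x) +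
      (-C / 4 - (A - C - B) / (4 * s)) * ((x ^ 2 - 1) / palQuartic d x) := by
  have hs0 : s ≠ 0 := by rintro rfl; norm_num at hs
  have e1 : palQuartic c x = x ^ 4 - s * x ^ 2 + 1 := by
    unfold palQuartic; linear_combination (-x ^ 2) * hc
  have e2 : palQuartic d x = x ^ 4 + s * x ^ 2 + 1 := by
    unfold palQuartic; linear_combination (-x ^ 2) * hd
  have e3 : 1 + x ^ 8 = (x ^ 4 - s * x ^ 2 + 1) * (x ^ 4 + s * x ^ 2 + 1) := by
    linear_combination x ^ 4 * hs
  rw [e1] at hqc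
  rw [e2] at hqd
  rw [e1, e2, e3]
  obtain ⟨p, hp⟩ : ∃ p, p = x ^ 4 - s * x ^ 2 + 1 := ⟨_, rfl⟩
  obtain ⟨q, hq⟩ : ∃ q, q = x ^ 4 + s * x ^ 2 + 1 := ⟨_, rfl⟩
  rw [← hp] at hqc
  rw [← hq] at hqd
  rw [← hp, ← hq]
  field_simp
  rw [hp, hq]
  ring

lemma integral_even_quartic_div {s c d : ℝ} (hs : s ^ 2 = 2) (hc0 : 0 < c) (hd0 : 0 < d)
    (hc : c ^ 2 = 2 + s) (hd : d ^ 2 = 2 - s) (A B C : ℝ) :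
    ∫ x : ℝ, (A * x ^ 4 + B * x ^ 2 + C) / (1 + x ^ 8) =
      ((A - C + B) / (4 * s) + C / 4) * (2 * π / d) +
      (C / 4 - (A - C + B) / (4 * s)) * (2 * π / c) := by
  have hc4 : c ^ 2 < 4 := by nlinarith
  have hd4 : d ^ 2 < 4 := by nlinarith
  simp_rw [fun x => even_quartic_div_eq hs hc hd A B C x (palQuartic_pos hc4 x).ne'
    (palQuartic_pos hd4 x).ne']
  have i1 := integrable_add_one_div_palQuartic hc4
  have i2 := integrable_add_one_div_palQuartic hd4
  have i3 := integrable_sub_one_div_palQuartic hc4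
  have i4 := integrable_sub_one_div_palQuartic hd4
  rw [integral_add (by fun_prop) (by fun_prop), integral_add (by fun_prop) (by fun_prop),
    integral_add (by fun_prop) (by fun_prop)]
  simp_rw [integral_const_mul]
  rw [integral_add_one_div_palQuartic hd0 (by linarith),
    integral_add_one_div_palQuartic hc0 (by linarith),
    integral_sub_one_div_palQuartic hc0.ne' hc4, integral_sub_one_div_palQuartic hd0.ne' hd4]
  ring

lemma integrable_shifted_quartic_div (t : ℝ) :
    Integrable fun x : ℝ => (x + t) ^ 4 / (1 + x ^ 8) := by
  refine (integrable_inv_one_add_sq.const_mul (32 * (1 + t ^ 4))).mono' ?_ ?_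
  · exact Continuous.aestronglyMeasurable
      (Continuous.div (by fun_prop) (by fun_prop) fun x => by positivity)
  · refine .of_forall fun x => ?_
    rw [Real.norm_of_nonneg (by positivity), ← div_eq_mul_inv,
      div_le_div_iff₀ (by positivity) (by positivity)]
    have h1 : (x + t) ^ 4 ≤ 8 * (x ^ 4 + t ^ 4) := by
      have := sq_nonneg (x - t)
      have : (x + t) ^ 2 ≤ 2 * (x ^ 2 + t ^ 2) := by nlinarith
      nlinarith [sq_nonneg (x ^ 2 - t ^ 2), pow_le_pow_left₀ (sq_nonneg (x + t)) this 2]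
    have h2 : x ^ 4 + t ^ 4 ≤ (1 + x ^ 4) * (1 + t ^ 4) := by
      nlinarith [mul_nonneg (pow_nonneg (sq_nonneg x) 2) (pow_nonneg (sq_nonneg t) 2)]
    have h3 : (1 + x ^ 4) * (1 + x ^ 2) ≤ 4 * (1 + x ^ 8) := by
      obtain ⟨y, hy⟩ : ∃ y, y = x ^ 2 := ⟨_, rfl⟩
      have e4 : x ^ 4 = y ^ 2 := by rw [hy]; ring
      have e8 : x ^ 8 = y ^ 4 := by rw [hy]; ring
      rw [e4, e8, ← hy]
      nlinarith [sq_nonneg (y - 1), sq_nonneg (y ^ 2 - 1), sq_nonneg (y ^ 2 - y),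
        sq_nonneg (y ^ 2)]
    calc (x + t) ^ 4 * (1 + x ^ 2) ≤ 8 * ((1 + x ^ 4) * (1 + t ^ 4)) * (1 + x ^ 2) := by
          gcongr; linarith
      _ = 8 * (1 + t ^ 4) * ((1 + x ^ 4) * (1 + x ^ 2)) := by ring
      _ ≤ 8 * (1 + t ^ 4) * (4 * (1 + x ^ 8)) := by gcongr
      _ = 32 * (1 + t ^ 4) * (1 + x ^ 8) := by ring

/-- Rescaling a single peak of the spectral density to the standard one. -/
lemma peak_rescale {a : ℝ} (ha : 0 < a) (b ω : ℝ) :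
    ω ^ 4 * (1 / (a ^ 8 + (ω - b) ^ 8)) =
      (a ^ 4)⁻¹ * (((ω - b) / a + b / a) ^ 4 / (1 + ((ω - b) / a) ^ 8)) := by
  have h1 : a ^ 8 + (ω - b) ^ 8 = a ^ 8 * (1 + ((ω - b) / a) ^ 8) := by
    field_simp
  have h2 : (ω - b) / a + b / a = ω / a := by ring
  have h3 : 1 + ((ω - b) / a) ^ 8 ≠ 0 := by positivity
  rw [h1, h2]
  field_simp

lemma integrable_peak {a : ℝ} (ha : 0 < a) (b : ℝ) :
    Integrable fun ω : ℝ => ω ^ 4 * (1 / (a ^ 8 + (ω - b) ^ 8)) := by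
  simp_rw [peak_rescale ha b]
  exact (((integrable_shifted_quartic_div (b / a)).comp_div ha.ne').comp_sub_right b).const_mul _

lemma integral_peak {a : ℝ} (ha : 0 < a) (b : ℝ) :
    ∫ ω : ℝ, ω ^ 4 * (1 / (a ^ 8 + (ω - b) ^ 8)) =
      (a ^ 3)⁻¹ * ∫ x : ℝ, (x + b / a) ^ 4 / (1 + x ^ 8) := by
  simp_rw [peak_rescale ha b]
  rw [integral_const_mul,
    integral_sub_right_eq_self (fun ω => (ω / a + b / a) ^ 4 / (1 + (ω / a) ^ 8)) b,
    Measure.integral_comp_div (fun x => (x + b / a) ^ 4 / (1 + x ^ 8)) a, abs_of_pos ha,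
    smul_eq_mul]
  field_simp

lemma integral_two_peaks {a : ℝ} (ha : 0 < a) (b : ℝ) :
    ∫ ω : ℝ, ω ^ 4 * (1 / (a ^ 8 + (ω - b) ^ 8) + 1 / (a ^ 8 + (ω + b) ^ 8)) =
      (a ^ 3)⁻¹ * ∫ x : ℝ, (2 * x ^ 4 + 12 * (b / a) ^ 2 * x ^ 2 + 2 * (b / a) ^ 4) /
        (1 + x ^ 8) := by
  have h1 := integrable_peak ha b
  have h2 := integrable_peak ha (-b)
  have e2 := integral_peak ha (-b)
  simp only [sub_neg_eq_add] at h2 e2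
  simp_rw [mul_add]
  rw [integral_add h1 h2, integral_peak ha b, e2, ← mul_add,
    ← integral_add (integrable_shifted_quartic_div _) (integrable_shifted_quartic_div _)]
  congr 2
  ext x
  rw [← add_div]
  congr 1
  ring

/-- The power spectral density `S` is normalized: `∫ S(ω) dω = 1`. -/
theorem stmt_17 (a ω₀ : ℝ) (ha : 0 < a) :
    ∫ ω : ℝ, Spsd a ω₀ ω = 1 := by
  set s := √2 with hs_def
  have hs : s ^ 2 = 2 := sq_sqrt zero_le_two
  have hs0 : 0 < s := sqrt_pos.2 two_pos
  have hs2 : s < 2 := by nlinarith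
  have hc0 : 0 < √(2 + s) := sqrt_pos.2 (by linarith)
  have hd0 : 0 < √(2 - s) := sqrt_pos.2 (by linarith)
  have hc : √(2 + s) ^ 2 = 2 + s := sq_sqrt (by linarith)
  have hd : √(2 - s) ^ 2 = 2 - s := sq_sqrt (by linarith)
  set c := √(2 + s)
  set d := √(2 - s)
  have hcd : c * d = s := by
    rw [← sq_eq_sq₀ (by positivity) hs0.le, mul_pow, hc, hd]
    linear_combination -2 * hs
  have hdc : d * (1 + s) = c := by
    rw [← sq_eq_sq₀ (by positivity) hc0.le, mul_pow, hc, hd]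
    linear_combination -s * hs
  have hr : √(1 - 1 / s) = d / s := by
    have : 1 - 1 / s = (d / s) ^ 2 := by
      rw [div_pow, hd]
      field_simp
      linear_combination hs
    rw [this, sqrt_sq (by positivity)]
  set u := ω₀ / a with hu
  have hA : Anor a ω₀ = ((1 + s) * u ^ 4 + 6 * u ^ 2 + 1) * (d / s) := by
    rw [Anor, ← hs_def, hr, hu]
    ring
  have hA0 : 0 < Anor a ω₀ := by rw [hA]; positivity
  have e1 : 2 * π / d = 2 * π * (d * (1 + s)) / s := by
    rw [hdc, ← hcd]
    field_simp
  have e2 : 2 * π / c = 2 * π * d / s := by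
    rw [← hcd]
    field_simp
  have hI : ∫ x : ℝ, (2 * x ^ 4 + 12 * u ^ 2 * x ^ 2 + 2 * u ^ 4) / (1 + x ^ 8) =
      π * Anor a ω₀ := by
    rw [integral_even_quartic_div hs hc0 hd0 hc hd, hA, e1, e2]
    field_simp
    ring
  have hS (ω : ℝ) : Spsd a ω₀ ω = a ^ 3 / (π * Anor a ω₀) *
      (ω ^ 4 * (1 / (a ^ 8 + (ω - ω₀) ^ 8) + 1 / (a ^ 8 + (ω + ω₀) ^ 8))) := by
    rw [Spsd]
    ring
  simp_rw [hS]
  rw [integral_const_mul, integral_two_peaks ha, ← hu, hI]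
  field_simp
end

section
/- Let a > 0 and ω₀ ∈ ℝ, and define S(ω) = (ω⁴·a³/(π·A_nor))·(1/(a⁸ + (ω − ω₀)⁸) + 1/(a⁸ + (ω + ω₀)⁸)) with A_nor = ((1 + √2)·ω₀⁴/a⁴ + 6·ω₀²/a² + 1)·√(1 − 1/√2). For k = 0, 1, 2, 3 set γ_k = i·e^{−3iπ/8}·e^{ikπ/4}, and for w ∈ ℝ and z ∈ ℂ define G₀(z, w) = Σ_{k=0}^{3} γ_k·(a·γ_k + w)⁴ / (z − i·(a·γ_k + w)). Then for every z ∈ ℂ with Re z > 0, the extended power spectral density satisfies G(z) = (1/2π)·∫_{−∞}^{∞} S(ω)/(z − iω) dω = (1/(8·i·π·a⁴·A_nor))·(G₀(z, ω₀) + G₀(z, −ω₀)). -/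
/-- `γ_k = i·e^{−3iπ/8}·e^{ikπ/4}`. -/
noncomputable def gam (k : ℕ) : ℂ :=
  Complex.I * Complex.exp (-3 * Complex.I * Real.pi / 8) *
    Complex.exp (k * Real.pi * Complex.I / 4)

/-- `G₀(z, w) = Σ_{k=0}^{3} γ_k·(aγ_k + w)⁴/(z − i(aγ_k + w))`. -/
noncomputable def G0 (a : ℝ) (z w : ℂ) : ℂ :=
  ∑ k ∈ Finset.range 4,
    gam k * ((a : ℂ) * gam k + w) ^ 4 / (z - Complex.I * ((a : ℂ) * gam k + w))

open Filter Topology MeasureTheory Complex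

theorem memLp_two_inv_sub {p : ℂ} (hp : p.im ≠ 0) :
    MemLp (fun x : ℝ => ((x : ℂ) - p)⁻¹) 2 := by
  have hne : ∀ x : ℝ, (x : ℂ) - p ≠ 0 := fun x h => hp (by simpa using congrArg Complex.im h)
  have hc : Continuous fun x : ℝ => ((x : ℂ) - p)⁻¹ :=
    (Complex.continuous_ofReal.sub continuous_const).inv₀ hne
  rw [memLp_two_iff_integrable_sq_norm hc.aestronglyMeasurable]
  have h := ((integrable_inv_one_add_sq.comp_div hp).comp_sub_right p.re).const_mul (p.im ^ 2)⁻¹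
  refine h.congr (Eventually.of_forall fun x => ?_)
  simp only [norm_inv, inv_pow, ← Complex.normSq_eq_norm_sq, Complex.normSq_apply]
  simp only [Complex.sub_re, Complex.sub_im, Complex.ofReal_re, Complex.ofReal_im]
  rw [← mul_inv]
  congr 1
  field_simp
  ring

theorem integrable_inv_sub_mul_inv_sub {p q : ℂ} (hp : p.im ≠ 0) (hq : q.im ≠ 0) :
    Integrable fun x : ℝ => ((x : ℂ) - p)⁻¹ * ((x : ℂ) - q)⁻¹ :=
  (memLp_two_inv_sub hp).integrable_mul (memLp_two_inv_sub hq)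

theorem tendsto_log_mul_sub_sub_log_atTop {c : ℂ} (hc : c ∈ slitPlane) (p : ℂ) :
    Tendsto (fun x : ℝ => log (c * ((x : ℂ) - p)) - (Real.log x : ℂ)) atTop (𝓝 (log c)) := by
  have h1 : Tendsto (fun x : ℝ => c * (1 - p * ((x⁻¹ : ℝ) : ℂ))) atTop (𝓝 c) := by
    have h := ((Complex.continuous_ofReal.tendsto 0).comp tendsto_inv_atTop_zero).const_mul p
    simpa using (h.const_sub 1).const_mul c
  have hev : ∀ᶠ x : ℝ in atTop, c * (1 - p * ((x⁻¹ : ℝ) : ℂ)) ∈ slitPlane :=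
    h1 (isOpen_slitPlane.mem_nhds hc)
  refine (h1.clog hc).congr' ?_
  filter_upwards [hev, eventually_gt_atTop 0] with x hx hx0
  have hx' : (x : ℂ) ≠ 0 := by exact_mod_cast hx0.ne'
  have : c * ((x : ℂ) - p) = (x : ℂ) * (c * (1 - p * ((x⁻¹ : ℝ) : ℂ))) := by
    push_cast
    field_simp
  rw [this, Complex.log_ofReal_mul hx0 (slitPlane_ne_zero hx)]
  ring

theorem tendsto_log_mul_sub_sub_log_atBot {c : ℂ} (hc : -c ∈ slitPlane) (p : ℂ) :
    Tendsto (fun x : ℝ => log (c * ((x : ℂ) - p)) - (Real.log x : ℂ)) atBot (𝓝 (log (-c))) := by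
  refine ((tendsto_log_mul_sub_sub_log_atTop hc (-p)).comp tendsto_neg_atBot_atTop).congr
    fun x => ?_
  simp only [Function.comp_apply, Real.log_neg_eq_log]
  congr 2
  push_cast
  ring

theorem hasDerivAt_log_mul_sub {c p : ℂ} (x : ℝ) (h : c * ((x : ℂ) - p) ∈ slitPlane) :
    HasDerivAt (fun x : ℝ => log (c * ((x : ℂ) - p))) ((x : ℂ) - p)⁻¹ x := by
  have h1 : HasDerivAt (fun x : ℝ => c * ((x : ℂ) - p)) (c * 1) x :=
    (Complex.ofRealCLM.hasDerivAt.sub_const p).const_mul c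
  convert h1.clog_real h using 1
  have := slitPlane_ne_zero h
  have hc := left_ne_zero_of_mul this
  have hx := right_ne_zero_of_mul this
  field_simp

theorem integral_inv_sub_mul_inv_sub_of_slitPlane {p q c d : ℂ} (hp : p.im ≠ 0) (hq : q.im ≠ 0)
    (hpq : p ≠ q) (hc : c ∈ slitPlane) (hc' : -c ∈ slitPlane) (hd : d ∈ slitPlane)
    (hd' : -d ∈ slitPlane) (hcp : ∀ x : ℝ, c * ((x : ℂ) - p) ∈ slitPlane)
    (hdq : ∀ x : ℝ, d * ((x : ℂ) - q) ∈ slitPlane) :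
    ∫ x : ℝ, ((x : ℂ) - p)⁻¹ * ((x : ℂ) - q)⁻¹ =
      ((log c - log d) - (log (-c) - log (-d))) / (p - q) := by
  have hpq' := sub_ne_zero.2 hpq
  have key := integral_of_hasDerivAt_of_tendsto
    (f := fun x : ℝ => (log (c * ((x : ℂ) - p)) - log (d * ((x : ℂ) - q))) / (p - q))
    (f' := fun x : ℝ => ((x : ℂ) - p)⁻¹ * ((x : ℂ) - q)⁻¹)
    (m := (log (-c) - log (-d)) / (p - q)) (n := (log c - log d) / (p - q))
    (fun x => ?_) (integrable_inv_sub_mul_inv_sub hp hq) ?_ ?_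
  · rw [key]
    ring
  · refine (((hasDerivAt_log_mul_sub x (hcp x)).fun_sub
      (hasDerivAt_log_mul_sub x (hdq x))).div_const (p - q)).congr_deriv ?_
    have h1 := right_ne_zero_of_mul (slitPlane_ne_zero (hcp x))
    have h2 := right_ne_zero_of_mul (slitPlane_ne_zero (hdq x))
    field_simp
    ring
  · refine Tendsto.div_const ?_ _
    simpa using (tendsto_log_mul_sub_sub_log_atBot hc' p).sub
      (tendsto_log_mul_sub_sub_log_atBot hd' q)
  · refine Tendsto.div_const ?_ _
    simpa using (tendsto_log_mul_sub_sub_log_atTop hc p).sub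
      (tendsto_log_mul_sub_sub_log_atTop hd q)

theorem integral_inv_sub_mul_inv_sub_of_im_pos_of_im_neg {p q : ℂ} (hp : 0 < p.im)
    (hq : q.im < 0) :
    ∫ x : ℝ, ((x : ℂ) - p)⁻¹ * ((x : ℂ) - q)⁻¹ = 2 * Real.pi * I / (p - q) := by
  rw [integral_inv_sub_mul_inv_sub_of_slitPlane (c := I) (d := -I) hp.ne' hq.ne
    (fun h => by rw [h] at hp; linarith) (by simp [mem_slitPlane_iff])
    (by simp [mem_slitPlane_iff]) (by simp [mem_slitPlane_iff]) (by simp [mem_slitPlane_iff])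
    (fun x => by simp [mem_slitPlane_iff, hp]) (fun x => by simp [mem_slitPlane_iff, hq])]
  simp only [neg_neg, log_I, log_neg_I]
  ring

theorem integral_inv_sub_mul_inv_sub_of_im_neg {p q : ℂ} (hp : p.im < 0) (hq : q.im < 0) :
    ∫ x : ℝ, ((x : ℂ) - p)⁻¹ * ((x : ℂ) - q)⁻¹ = 0 := by
  rcases eq_or_ne p q with rfl | hpq
  · have hne : ∀ x : ℝ, (x : ℂ) - p ≠ 0 :=
      fun x h => hp.ne (by simpa using congrArg Complex.im h)
    have hlim : ∀ l : Filter ℝ, Tendsto (fun x : ℝ => (x : ℂ)) l (Bornology.cobounded ℂ) →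
        Tendsto (fun x : ℝ => -((x : ℂ) - p)⁻¹) l (𝓝 0) := fun l hl => by
      simpa using (tendsto_inv₀_cobounded.comp
        ((tendsto_sub_const_cobounded p).comp hl)).neg
    have hderiv : ∀ x : ℝ, HasDerivAt (fun x : ℝ => -((x : ℂ) - p)⁻¹)
        (((x : ℂ) - p)⁻¹ * ((x : ℂ) - p)⁻¹) x := fun x => by
      refine ((Complex.ofRealCLM.hasDerivAt.sub_const p).fun_inv (hne x)).fun_neg.congr_deriv ?_
      simp [neg_div, sq]
    rw [integral_of_hasDerivAt_of_tendsto hderiv (integrable_inv_sub_mul_inv_sub hp.ne hp.ne)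
      (hlim _ ?_) (hlim _ ?_), sub_zero]
    · exact tendsto_norm_atTop_iff_cobounded.1
        (by simpa [Function.comp_def] using tendsto_abs_atBot_atTop)
    · exact tendsto_norm_atTop_iff_cobounded.1
        (by simpa [Function.comp_def] using tendsto_abs_atTop_atTop)
  · rw [integral_inv_sub_mul_inv_sub_of_slitPlane (c := -I) (d := -I) hp.ne hq.ne hpq
      (by simp [mem_slitPlane_iff])
      (by simp [mem_slitPlane_iff]) (by simp [mem_slitPlane_iff]) (by simp [mem_slitPlane_iff])
      (fun x => by simp [mem_slitPlane_iff, hp]) (fun x => by simp [mem_slitPlane_iff, hq])]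
    simp

theorem gam_eq_exp (k : ℕ) : gam k = exp (((2 * k + 1) * Real.pi / 8 : ℝ) * I) := by
  rw [gam]
  nth_rw 1 [← exp_pi_div_two_mul_I]
  rw [← exp_add, ← exp_add]
  congr 1
  push_cast
  ring

theorem gam_eq_pow (k : ℕ) : gam k = gam 0 ^ (2 * k + 1) := by
  rw [gam_eq_exp, gam_eq_exp, ← exp_nat_mul]
  congr 1
  push_cast
  ring

theorem isPrimitiveRoot_gam_zero : IsPrimitiveRoot (gam 0) 16 := by
  convert Complex.isPrimitiveRoot_exp 16 (by norm_num) using 1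
  rw [gam_eq_exp]
  congr 1
  push_cast
  ring

theorem gam_zero_pow_eight : gam 0 ^ 8 = -1 := by
  rw [gam_eq_exp, ← exp_nat_mul, ← exp_pi_mul_I]
  congr 1
  push_cast
  ring

theorem gam_pow_eight (k : ℕ) : gam k ^ 8 = -1 := by
  rw [gam_eq_pow, ← pow_mul, mul_comm, pow_mul, gam_zero_pow_eight]
  exact Odd.neg_one_pow ⟨k, rfl⟩

theorem gam_im (k : ℕ) : (gam k).im = Real.sin ((2 * k + 1) * Real.pi / 8) := by
  rw [gam_eq_exp, exp_ofReal_mul_I_im]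

theorem gam_im_pos {k : ℕ} (hk : k < 4) : 0 < (gam k).im := by
  rw [gam_im]
  have : (k : ℝ) + 1 ≤ 4 := by exact_mod_cast hk
  have := Real.pi_pos
  exact Real.sin_pos_of_pos_of_lt_pi (by positivity) (by nlinarith)

theorem gam_add_four (k : ℕ) : gam (k + 4) = -gam k := by
  rw [gam_eq_pow, gam_eq_pow k, show 2 * (k + 4) + 1 = 8 + (2 * k + 1) by ring, pow_add,
    gam_zero_pow_eight]
  ring

theorem nodal_mul_gam_add (a w : ℂ) :
    Lagrange.nodal (Finset.range 8) (fun k => a * gam k + w) =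
      (Polynomial.X - Polynomial.C w) ^ 8 + Polynomial.C (a ^ 8) := by
  refine Polynomial.funext fun x => ?_
  have h8 := gam_zero_pow_eight
  have h1 : gam 1 ^ 2 = gam 0 ^ 6 := by rw [gam_eq_pow 1]; ring
  have h2 : gam 2 ^ 2 = -gam 0 ^ 2 := by rw [gam_eq_pow 2]; linear_combination gam 0 ^ 2 * h8
  have h3 : gam 3 ^ 2 = -gam 0 ^ 6 := by rw [gam_eq_pow 3]; linear_combination gam 0 ^ 6 * h8
  simp only [Lagrange.eval_nodal, Finset.prod_range_succ, Finset.prod_range_zero, one_mul,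
    Polynomial.eval_add, Polynomial.eval_pow, Polynomial.eval_sub, Polynomial.eval_X, Polynomial.eval_C]
  rw [show gam 4 = -gam 0 from gam_add_four 0, show gam 5 = -gam 1 from gam_add_four 1,
    show gam 6 = -gam 2 from gam_add_four 2, show gam 7 = -gam 3 from gam_add_four 3]
  set t := x - w with ht
  calc _ = (t ^ 2 - a ^ 2 * gam 0 ^ 2) * (t ^ 2 - a ^ 2 * gam 1 ^ 2) *
        (t ^ 2 - a ^ 2 * gam 2 ^ 2) * (t ^ 2 - a ^ 2 * gam 3 ^ 2) := by rw [ht]; ring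
    _ = _ := by
      rw [h1, h2, h3]
      linear_combination (-a ^ 4 * t ^ 4 * gam 0 ^ 4 + a ^ 8 * (gam 0 ^ 8 - 1)) * h8

theorem mul_gam_add_injOn {a : ℂ} (ha : a ≠ 0) (w : ℂ) :
    Set.InjOn (fun k => a * gam k + w) (Finset.range 8) := by
  intro i hi j hj h
  have h' : gam i = gam j := mul_left_cancel₀ ha (add_right_cancel h)
  rw [gam_eq_pow i, gam_eq_pow j] at h'
  simp only [Finset.coe_range, Set.mem_Iio] at hi hj
  have := isPrimitiveRoot_gam_zero.pow_inj (by omega) (by omega) h'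
  omega

/-- Partial fraction decomposition of `f(x) / (a⁸ + (x - w)⁸)`. -/
theorem eval_div_eq_sum_gam {a : ℂ} (ha : a ≠ 0) (w : ℂ) {f : Polynomial ℂ} (hf : f.degree < 8)
    {x : ℂ} (hx : ∀ k < 8, x ≠ a * gam k + w) :
    f.eval x / (a ^ 8 + (x - w) ^ 8) =
      ∑ k ∈ Finset.range 8,
        -(gam k * f.eval (a * gam k + w) / (8 * a ^ 7)) * (x - (a * gam k + w))⁻¹ := by
  have hinj := mul_gam_add_injOn ha w
  have hnodal := nodal_mul_gam_add a w
  have hev : (Lagrange.nodal (Finset.range 8) (fun k => a * gam k + w)).eval x =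
      a ^ 8 + (x - w) ^ 8 := by
    rw [hnodal]; simp; ring
  have hne : a ^ 8 + (x - w) ^ 8 ≠ 0 := by
    rw [← hev, Lagrange.eval_nodal, Finset.prod_ne_zero_iff]
    exact fun k hk => sub_ne_zero.2 (hx k (Finset.mem_range.1 hk))
  rw [div_eq_iff hne]
  conv_lhs => rw [Lagrange.eq_interpolate (f := f) hinj (by simpa using hf)]
  rw [Lagrange.eval_interpolate_not_at_node _ fun k hk => hx k (Finset.mem_range.1 hk), hev,
    mul_comm]
  congr 1
  refine Finset.sum_congr rfl fun k hk => ?_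
  rw [Lagrange.nodalWeight_eq_eval_derivative_nodal hk, hnodal]
  have h8 := gam_pow_eight k
  have hg : gam k ≠ 0 := fun h => by simp [h] at h8
  simp [Polynomial.derivative_pow]
  field_simp
  linear_combination f.eval (a * gam k + w) * (x - (a * gam k + w))⁻¹ * h8

theorem integral_psd_term {a : ℝ} (ha : 0 < a) (w : ℝ) {z : ℂ} (hz : 0 < z.re) :
    Integrable (fun x : ℝ => (x : ℂ) ^ 4 / ((a : ℂ) ^ 8 + ((x : ℂ) - w) ^ 8) / (z - I * x)) ∧
    ∫ x : ℝ, (x : ℂ) ^ 4 / ((a : ℂ) ^ 8 + ((x : ℂ) - w) ^ 8) / (z - I * x) =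
      2 * Real.pi / (8 * I * (a : ℂ) ^ 7) * G0 a z w := by
  have ha' : (a : ℂ) ≠ 0 := by exact_mod_cast ha.ne'
  have him : ∀ k, ((a : ℂ) * gam k + w).im = a * (gam k).im := fun k => by simp
  have hpos : ∀ k < 4, 0 < ((a : ℂ) * gam k + w).im := fun k hk => by
    rw [him]; exact mul_pos ha (gam_im_pos hk)
  have hneg : ∀ k < 4, ((a : ℂ) * gam (4 + k) + w).im < 0 := fun k hk => by
    rw [him, add_comm, gam_add_four, neg_im]
    exact mul_neg_of_pos_of_neg ha (neg_neg_of_pos (gam_im_pos hk))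
  have hne : ∀ k < 8, ((a : ℂ) * gam k + w).im ≠ 0 := fun k hk => by
    rcases lt_or_ge k 4 with h | h
    · exact (hpos k h).ne'
    · obtain ⟨j, rfl⟩ := Nat.exists_eq_add_of_le h
      exact (hneg j (by omega)).ne
  have hq : (-I * z).im < 0 := by simpa using hz
  have hfun : (fun x : ℝ => (x : ℂ) ^ 4 / ((a : ℂ) ^ 8 + ((x : ℂ) - w) ^ 8) / (z - I * x)) =
      fun x : ℝ => ∑ k ∈ Finset.range 8,
        -(I * (gam k * ((a : ℂ) * gam k + w) ^ 4 / (8 * (a : ℂ) ^ 7))) *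
          (((x : ℂ) - (a * gam k + w))⁻¹ * ((x : ℂ) - (-I * z))⁻¹) := by
    funext x
    have h := eval_div_eq_sum_gam ha' w (f := Polynomial.X ^ 4) (x := x)
      (by rw [Polynomial.degree_X_pow]; norm_num)
      (fun k hk h => hne k hk (by rw [← h]; simp))
    simp only [Polynomial.eval_pow, Polynomial.eval_X] at h
    have hz' : (z - I * x)⁻¹ = I * ((x : ℂ) - (-I * z))⁻¹ := by
      have : z - I * x = -I * ((x : ℂ) - (-I * z)) := by linear_combination z * I_sq
      rw [this, mul_inv, inv_neg, inv_I, neg_neg]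
    rw [h, div_eq_mul_inv, hz', Finset.sum_mul]
    refine Finset.sum_congr rfl fun k _ => ?_
    ring
  have hint : ∀ k ∈ Finset.range 8, Integrable fun x : ℝ =>
      -(I * (gam k * ((a : ℂ) * gam k + w) ^ 4 / (8 * (a : ℂ) ^ 7))) *
          (((x : ℂ) - (a * gam k + w))⁻¹ * ((x : ℂ) - (-I * z))⁻¹) := fun k hk =>
    (integrable_inv_sub_mul_inv_sub (hne k (Finset.mem_range.1 hk)) hq.ne).const_mul _
  rw [hfun]
  refine ⟨integrable_finsetSum _ hint, ?_⟩
  rw [integral_finsetSum _ hint]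
  simp only [integral_const_mul]
  rw [show (8 : ℕ) = 4 + 4 from rfl, Finset.sum_range_add, Finset.sum_eq_zero (s := Finset.range 4)
    (f := fun k => -(I * (gam (4 + k) * ((a : ℂ) * gam (4 + k) + w) ^ 4 / (8 * (a : ℂ) ^ 7))) *
      ∫ x : ℝ, ((x : ℂ) - (a * gam (4 + k) + w))⁻¹ * ((x : ℂ) - (-I * z))⁻¹) fun k hk => by
      rw [integral_inv_sub_mul_inv_sub_of_im_neg (hneg k (Finset.mem_range.1 hk)) hq, mul_zero],
    add_zero, G0, Finset.mul_sum]
  refine Finset.sum_congr rfl fun k hk => ?_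
  have hp := hpos k (Finset.mem_range.1 hk)
  rw [integral_inv_sub_mul_inv_sub_of_im_pos_of_im_neg hp hq]
  have hpq : (a : ℂ) * gam k + w - -I * z ≠ 0 := sub_ne_zero.2 fun h => by
    rw [h] at hp; linarith
  have hz' : z - I * ((a : ℂ) * gam k + w) = -I * ((a : ℂ) * gam k + w - -I * z) := by
    linear_combination z * I_sq
  rw [hz']
  generalize (a : ℂ) * gam k + w - -I * z = d at hpq
  have hI := I_ne_zero
  field_simp
  linear_combination -(gam k * ((a : ℂ) * gam k + w) ^ 4) * I_pow_four

/-- The extended power spectral density of `S` evaluated by residues: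
`G(z) = (1/2π)∫ S(ω)/(z − iω)dω = (G₀(z, ω₀) + G₀(z, −ω₀))/(8iπa⁴A_nor)`
for `Re z > 0`. -/
theorem stmt_18 (a ω₀ : ℝ) (ha : 0 < a) (z : ℂ) (hz : 0 < z.re) :
    (1 / (2 * (Real.pi : ℂ))) * ∫ ω : ℝ, (Spsd a ω₀ ω : ℂ) / (z - Complex.I * ω)
      = (1 / (8 * Complex.I * (Real.pi : ℂ) * (a : ℂ) ^ 4 * (Anor a ω₀ : ℂ))) *
          (G0 a z (ω₀ : ℂ) + G0 a z (-(ω₀ : ℂ))) := by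
  obtain ⟨i₁, e₁⟩ := integral_psd_term ha ω₀ hz
  obtain ⟨i₂, e₂⟩ := integral_psd_term ha (-ω₀) hz
  have ha' : (a : ℂ) ≠ 0 := by exact_mod_cast ha.ne'
  have hfun : (fun ω : ℝ => (Spsd a ω₀ ω : ℂ) / (z - I * ω)) = fun ω : ℝ =>
      (a : ℂ) ^ 3 / (Real.pi * Anor a ω₀) *
        ((ω : ℂ) ^ 4 / ((a : ℂ) ^ 8 + ((ω : ℂ) - ω₀) ^ 8) / (z - I * ω) +
          (ω : ℂ) ^ 4 / ((a : ℂ) ^ 8 + ((ω : ℂ) - (-ω₀ : ℝ)) ^ 8) / (z - I * ω)) := by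
    funext ω
    rw [Spsd]
    push_cast
    rw [sub_neg_eq_add]
    ring
  rw [hfun, integral_const_mul, integral_add i₁ i₂, e₁, e₂, ofReal_neg]
  have hpi : (Real.pi : ℂ) ≠ 0 := by exact_mod_cast Real.pi_ne_zero
  have hI := I_ne_zero
  rw [← mul_add, ← mul_assoc, ← mul_assoc]
  congr 1
  generalize (Anor a ω₀ : ℂ) = A
  rcases eq_or_ne A 0 with rfl | hA
  · simp
  · field_simp
end
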